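/- The learner's optimal expected utility over all no-regret menus equals the value of an explicit linear program. Precisely, for any probability weights α ∈ Δ_k: sup over all closed convex M ⊆ Δ_{mn} with M_NSR ⊆ M ⊆ M_NR of Σ_{i∈[k]} α_i V_L(M, u_{O,i}) equals the maximum of Σ_{i∈[k]} α_i u_L(φ_i) over all Φ = (φ_1,…,φ_k) ∈ (Δ_{mn})^k satisfying (1) φ_i ∈ M_NR for all i; (2) u_{O,i}(φ_i) ≥ u_{O,i}(φ_{i'}) for all i, i' ∈ [k]; and (3) u_{O,i}(φ_i) ≥ sup_{ψ ∈ M_NSR} u_{O,i}(ψ) for all i. Moreover this maximum is attained, and for a maximizer Φ* the supremum on the left is attained by the menu M = conv(M_NSR ∪ {φ*_1,…,φ*_k}). -/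

import Mathlib

open scoped BigOperators

noncomputable section

/-- Linear extension of a payoff function to CSPs. -/
def lin {m n : ℕ} (u : Fin m × Fin n → ℝ) (φ : Fin m × Fin n → ℝ) : ℝ :=
  ∑ p : Fin m × Fin n, φ p * u p

/-- The set `M_NR` of no-regret CSPs for learner payoff `uL`. -/
def MNR {m n : ℕ} (uL : Fin m × Fin n → ℝ) : Set (Fin m × Fin n → ℝ) :=
  {φ ∈ stdSimplex ℝ (Fin m × Fin n) |
    ∀ istar : Fin m, (∑ p : Fin m × Fin n, φ p * uL (istar, p.2)) ≤ lin uL φ}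

/-- The set `M_NSR` of no-swap-regret CSPs for learner payoff `uL`. -/
def MNSR {m n : ℕ} (uL : Fin m × Fin n → ℝ) : Set (Fin m × Fin n → ℝ) :=
  {φ ∈ stdSimplex ℝ (Fin m × Fin n) |
    ∀ i istar : Fin m,
      (∑ j : Fin n, φ (i, j) * uL (istar, j)) ≤ ∑ j : Fin n, φ (i, j) * uL (i, j)}

/-- `V_L(M, uO)`: the learner's value when the optimizer picks its
utility-maximizing CSP from `M`, breaking ties in the learner's favor. -/
def learnerVal {m n : ℕ} (uL uO : Fin m × Fin n → ℝ)
    (M : Set (Fin m × Fin n → ℝ)) : ℝ :=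
  sSup (lin uL '' {φ ∈ M | lin uO φ = sSup (lin uO '' M)})

/-- The feasible set of the linear program for optimal no-regret commitment. -/
def NRFeasible {m n k : ℕ} (uL : Fin m × Fin n → ℝ)
    (uO : Fin k → Fin m × Fin n → ℝ) (Φ : Fin k → Fin m × Fin n → ℝ) : Prop :=
  (∀ i, Φ i ∈ MNR uL) ∧
  (∀ i i', lin (uO i) (Φ i') ≤ lin (uO i) (Φ i)) ∧
  (∀ i, sSup (lin (uO i) '' MNSR uL) ≤ lin (uO i) (Φ i))

theorem IsCompact.convexJoin_real {E : Type*} [AddCommGroup E] [Module ℝ E] [TopologicalSpace E]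
    [ContinuousAdd E] [ContinuousSMul ℝ E] {s t : Set E} (hs : IsCompact s) (ht : IsCompact t) :
    IsCompact (convexJoin ℝ s t) := by
  have h : convexJoin ℝ s t = (fun q : ℝ × E × E => (1 - q.1) • q.2.1 + q.1 • q.2.2) ''
      (Set.Icc (0 : ℝ) 1 ×ˢ s ×ˢ t) := by
    ext x
    simp only [mem_convexJoin, segment_eq_image, Set.mem_image, Set.mem_prod, Prod.exists]
    constructor
    · rintro ⟨a, ha, b, hb, θ, hθ, rfl⟩
      exact ⟨θ, a, b, ⟨hθ, ha, hb⟩, rfl⟩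
    · rintro ⟨θ, a, b, ⟨hθ, ha, hb⟩, rfl⟩
      exact ⟨a, ha, b, hb, θ, hθ, rfl⟩
  rw [h]
  exact (isCompact_Icc.prod (hs.prod ht)).image (by fun_prop)

theorem continuous_lin {m n : ℕ} (u : Fin m × Fin n → ℝ) : Continuous (lin u) := by
  unfold lin
  fun_prop

theorem isLinearMap_lin {m n : ℕ} (u : Fin m × Fin n → ℝ) : IsLinearMap ℝ (lin u) where
  map_add x y := by simp [lin, add_mul, Finset.sum_add_distrib]
  map_smul c x := by simp [lin, mul_assoc, Finset.mul_sum]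

theorem MNR_eq {m n : ℕ} (uL : Fin m × Fin n → ℝ) :
    MNR uL = stdSimplex ℝ (Fin m × Fin n) ∩
      ⋂ i : Fin m, {φ | lin (fun p => uL (i, p.2) - uL p) φ ≤ 0} := by
  ext φ
  simp [MNR, lin, mul_sub, Finset.sum_sub_distrib]

theorem convex_MNR {m n : ℕ} (uL : Fin m × Fin n → ℝ) : Convex ℝ (MNR uL) := by
  rw [MNR_eq]
  exact (convex_stdSimplex ℝ _).inter
    (convex_iInter fun _ => convex_halfSpace_le (isLinearMap_lin _) 0)

theorem isCompact_MNR {m n : ℕ} (uL : Fin m × Fin n → ℝ) : IsCompact (MNR uL) := by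
  rw [MNR_eq]
  exact (isCompact_stdSimplex ℝ _).inter_right
    (isClosed_iInter fun _ => isClosed_le (continuous_lin _) continuous_const)

theorem MNSR_eq {m n : ℕ} (uL : Fin m × Fin n → ℝ) :
    MNSR uL = stdSimplex ℝ (Fin m × Fin n) ∩ ⋂ i : Fin m, ⋂ i' : Fin m,
      {φ | lin (fun p => if p.1 = i then uL (i', p.2) - uL p else 0) φ ≤ 0} := by
  have h : ∀ (i i' : Fin m) (φ : Fin m × Fin n → ℝ),
      lin (fun p => if p.1 = i then uL (i', p.2) - uL p else 0) φ
        = ∑ j, φ (i, j) * uL (i', j) - ∑ j, φ (i, j) * uL (i, j) := by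
    intro i i' φ
    rw [lin, Fintype.sum_prod_type, Finset.sum_eq_single i]
    · simp [mul_sub, Finset.sum_sub_distrib]
    · intro a _ ha
      simp [ha]
    · simp
  ext φ
  simp [MNSR, h]

theorem convex_MNSR {m n : ℕ} (uL : Fin m × Fin n → ℝ) : Convex ℝ (MNSR uL) := by
  rw [MNSR_eq]
  exact (convex_stdSimplex ℝ _).inter (convex_iInter fun _ => convex_iInter fun _ =>
    convex_halfSpace_le (isLinearMap_lin _) 0)

theorem isCompact_MNSR {m n : ℕ} (uL : Fin m × Fin n → ℝ) : IsCompact (MNSR uL) := by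
  rw [MNSR_eq]
  exact (isCompact_stdSimplex ℝ _).inter_right (isClosed_iInter fun _ => isClosed_iInter fun _ =>
    isClosed_le (continuous_lin _) continuous_const)

theorem MNSR_subset_MNR {m n : ℕ} (uL : Fin m × Fin n → ℝ) : MNSR uL ⊆ MNR uL := by
  rintro φ ⟨hφ, h⟩
  refine ⟨hφ, fun i' => ?_⟩
  rw [lin, Fintype.sum_prod_type, Fintype.sum_prod_type]
  exact Finset.sum_le_sum fun i _ => h i i'

theorem MNSR_nonempty {m n : ℕ} (hm : 0 < m) (hn : 0 < n) (uL : Fin m × Fin n → ℝ) :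
    (MNSR uL).Nonempty := by
  have : Nonempty (Fin m) := ⟨⟨0, hm⟩⟩
  let j₀ : Fin n := ⟨0, hn⟩
  obtain ⟨i₀, hi₀⟩ := Finite.exists_max fun i => uL (i, j₀)
  refine ⟨Pi.single (i₀, j₀) 1, single_mem_stdSimplex ℝ _, fun i i' => ?_⟩
  by_cases hi : i = i₀
  · subst hi
    have h : ∀ a : Fin m, ∑ j, (Pi.single (i, j₀) (1 : ℝ) : Fin m × Fin n → ℝ) (i, j) * uL (a, j)
        = uL (a, j₀) := fun a => by simp [Pi.single_apply]
    rw [h, h]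
    exact hi₀ i'
  · simp [hi]

theorem sSup_lin_image {m n : ℕ} {u : Fin m × Fin n → ℝ} {M : Set (Fin m × Fin n → ℝ)}
    {φ : Fin m × Fin n → ℝ} (hφ : φ ∈ M) (hmax : ∀ ψ ∈ M, lin u ψ ≤ lin u φ) :
    sSup (lin u '' M) = lin u φ :=
  IsGreatest.csSup_eq ⟨Set.mem_image_of_mem _ hφ, by rintro _ ⟨ψ, hψ, rfl⟩; exact hmax ψ hψ⟩

theorem le_learnerVal {m n : ℕ} {uL uO : Fin m × Fin n → ℝ} {M : Set (Fin m × Fin n → ℝ)}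
    (hM : IsCompact M) {φ : Fin m × Fin n → ℝ} (hφ : φ ∈ M)
    (hmax : ∀ ψ ∈ M, lin uO ψ ≤ lin uO φ) : lin uL φ ≤ learnerVal uL uO M :=
  le_csSup ((hM.bddAbove_image (continuous_lin uL).continuousOn).mono
      (Set.image_mono (Set.sep_subset _ _)))
    ⟨φ, ⟨hφ, (sSup_lin_image hφ hmax).symm⟩, rfl⟩

theorem exists_lin_eq_learnerVal {m n : ℕ} (uL uO : Fin m × Fin n → ℝ)
    {M : Set (Fin m × Fin n → ℝ)} (hM : IsCompact M) (hne : M.Nonempty) :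
    ∃ φ ∈ M, (∀ ψ ∈ M, lin uO ψ ≤ lin uO φ) ∧ lin uL φ = learnerVal uL uO M := by
  obtain ⟨φ₀, hφ₀, hmax₀⟩ := hM.exists_isMaxOn hne (continuous_lin uO).continuousOn
  have hs := sSup_lin_image hφ₀ hmax₀
  have hc : IsCompact {φ ∈ M | lin uO φ = sSup (lin uO '' M)} :=
    hM.inter_right (isClosed_eq (continuous_lin uO) continuous_const)
  obtain ⟨φ, ⟨hφ, he⟩, hmax⟩ := hc.exists_sSup_image_eq ⟨φ₀, hφ₀, hs.symm⟩
    (continuous_lin uL).continuousOn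
  exact ⟨φ, hφ, fun ψ hψ => by rw [he, hs]; exact hmax₀ hψ, hmax.symm⟩

theorem exists_NRFeasible_of_menu {m n k : ℕ} (hm : 0 < m) (hn : 0 < n)
    (uL : Fin m × Fin n → ℝ) (uO : Fin k → Fin m × Fin n → ℝ)
    {M : Set (Fin m × Fin n → ℝ)} (hc : IsClosed M) (h₁ : MNSR uL ⊆ M) (h₂ : M ⊆ MNR uL) :
    ∃ Φ, NRFeasible uL uO Φ ∧ ∀ i, lin uL (Φ i) = learnerVal uL (uO i) M := by
  have hne := MNSR_nonempty hm hn uL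
  have hM : IsCompact M := (isCompact_MNR uL).of_isClosed_subset hc h₂
  choose Φ hΦ hmax hval using fun i => exists_lin_eq_learnerVal uL (uO i) hM (hne.mono h₁)
  refine ⟨Φ, ⟨fun i => h₂ (hΦ i), fun i i' => hmax i _ (hΦ i'), fun i => ?_⟩, hval⟩
  refine csSup_le (hne.image _) ?_
  rintro _ ⟨ψ, hψ, rfl⟩
  exact hmax i ψ (h₁ hψ)

theorem isCompact_setOf_NRFeasible {m n k : ℕ} (uL : Fin m × Fin n → ℝ)
    (uO : Fin k → Fin m × Fin n → ℝ) : IsCompact {Φ | NRFeasible uL uO Φ} := by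
  have hl : ∀ (u : Fin m × Fin n → ℝ) (i : Fin k),
      Continuous fun Φ : Fin k → Fin m × Fin n → ℝ => lin u (Φ i) :=
    fun u i => (continuous_lin u).comp (continuous_apply i)
  have h : {Φ | NRFeasible uL uO Φ} = Set.univ.pi (fun _ => MNR uL) ∩
      ((⋂ i, ⋂ i', {Φ | lin (uO i) (Φ i') ≤ lin (uO i) (Φ i)}) ∩
        ⋂ i, {Φ | sSup (lin (uO i) '' MNSR uL) ≤ lin (uO i) (Φ i)}) := by
    ext Φ
    simp [NRFeasible, Set.mem_pi]
  rw [h]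
  exact (isCompact_univ_pi fun _ => isCompact_MNR uL).inter_right
    ((isClosed_iInter fun i => isClosed_iInter fun i' => isClosed_le (hl _ _) (hl _ _)).inter
      (isClosed_iInter fun i => isClosed_le continuous_const (hl _ _)))

theorem lin_le_of_mem_convexHull {m n k : ℕ} {uL : Fin m × Fin n → ℝ}
    {uO : Fin k → Fin m × Fin n → ℝ} {Φ : Fin k → Fin m × Fin n → ℝ}
    (hΦ : NRFeasible uL uO Φ) (i : Fin k) {ψ : Fin m × Fin n → ℝ}
    (hψ : ψ ∈ convexHull ℝ (MNSR uL ∪ Set.range Φ)) : lin (uO i) ψ ≤ lin (uO i) (Φ i) := by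
  refine convexHull_min ?_ (convex_halfSpace_le (isLinearMap_lin (uO i)) (lin (uO i) (Φ i))) hψ
  rintro χ (hχ | ⟨i', rfl⟩)
  · exact (le_csSup ((isCompact_MNSR uL).bddAbove_image (continuous_lin (uO i)).continuousOn)
      (Set.mem_image_of_mem _ hχ)).trans (hΦ.2.2 i)
  · exact hΦ.2.1 i i'

/-- the learner's optimal expected utility over all no-regret
menus equals the value of the explicit linear program; the LP maximum is
attained, and for a maximizer `Φ*` the menu `conv(M_NSR ∪ {φ*_1,…,φ*_k})`
attains the supremum. -/
theorem optimal_noRegret_commitment_LP {m n k : ℕ}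
    (hm : 0 < m) (hn : 0 < n) (hk : 0 < k)
    (uL : Fin m × Fin n → ℝ) (uO : Fin k → Fin m × Fin n → ℝ)
    (α : Fin k → ℝ) (hα : α ∈ stdSimplex ℝ (Fin k)) :
    ∃ Φstar : Fin k → Fin m × Fin n → ℝ,
      NRFeasible uL uO Φstar ∧
      (∀ Φ : Fin k → Fin m × Fin n → ℝ, NRFeasible uL uO Φ →
        ∑ i, α i * lin uL (Φ i) ≤ ∑ i, α i * lin uL (Φstar i)) ∧
      sSup {r : ℝ | ∃ M : Set (Fin m × Fin n → ℝ),
          IsClosed M ∧ Convex ℝ M ∧ MNSR uL ⊆ M ∧ M ⊆ MNR uL ∧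
          r = ∑ i, α i * learnerVal uL (uO i) M}
        = ∑ i, α i * lin uL (Φstar i) ∧
      (IsClosed (convexHull ℝ (MNSR uL ∪ Set.range Φstar)) ∧
       Convex ℝ (convexHull ℝ (MNSR uL ∪ Set.range Φstar)) ∧
       MNSR uL ⊆ convexHull ℝ (MNSR uL ∪ Set.range Φstar) ∧
       convexHull ℝ (MNSR uL ∪ Set.range Φstar) ⊆ MNR uL ∧
       ∑ i, α i * learnerVal uL (uO i) (convexHull ℝ (MNSR uL ∪ Set.range Φstar))
         = ∑ i, α i * lin uL (Φstar i)) := by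
  obtain ⟨Φ₀, hΦ₀, -⟩ := exists_NRFeasible_of_menu hm hn uL uO (isCompact_MNSR uL).isClosed
    subset_rfl (MNSR_subset_MNR uL)
  have hcont : Continuous fun Φ : Fin k → Fin m × Fin n → ℝ => ∑ i, α i * lin uL (Φ i) :=
    continuous_finsetSum _ fun i _ =>
      continuous_const.mul ((continuous_lin uL).comp (continuous_apply i))
  obtain ⟨Φ, hΦ, hopt⟩ :=
    (isCompact_setOf_NRFeasible uL uO).exists_isMaxOn ⟨Φ₀, hΦ₀⟩ hcont.continuousOn
  have hle : ∀ M : Set (Fin m × Fin n → ℝ), IsClosed M → MNSR uL ⊆ M → M ⊆ MNR uL →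
      ∑ i, α i * learnerVal uL (uO i) M ≤ ∑ i, α i * lin uL (Φ i) := by
    intro M hc h₁ h₂
    obtain ⟨Ψ, hΨ, hval⟩ := exists_NRFeasible_of_menu hm hn uL uO hc h₁ h₂
    simp_rw [← hval]
    exact hopt hΨ
  have hcomp : IsCompact (convexHull ℝ (MNSR uL ∪ Set.range Φ)) := by
    have : Nonempty (Fin k) := ⟨⟨0, hk⟩⟩
    rw [convexHull_union (MNSR_nonempty hm hn uL) (Set.range_nonempty Φ),
      (convex_MNSR uL).convexHull_eq]
    exact (isCompact_MNSR uL).convexJoin_real ((Set.finite_range Φ).isCompact_convexHull ℝ)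
  have hconv : Convex ℝ (convexHull ℝ (MNSR uL ∪ Set.range Φ)) := convex_convexHull ℝ _
  have hsub₁ : MNSR uL ⊆ convexHull ℝ (MNSR uL ∪ Set.range Φ) :=
    Set.subset_union_left.trans (subset_convexHull ℝ _)
  have hsub₂ : convexHull ℝ (MNSR uL ∪ Set.range Φ) ⊆ MNR uL :=
    convexHull_min (Set.union_subset (MNSR_subset_MNR uL) (Set.range_subset_iff.2 hΦ.1))
      (convex_MNR uL)
  have hval : ∑ i, α i * learnerVal uL (uO i) (convexHull ℝ (MNSR uL ∪ Set.range Φ))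
      = ∑ i, α i * lin uL (Φ i) := by
    refine le_antisymm (hle _ hcomp.isClosed hsub₁ hsub₂) (Finset.sum_le_sum fun i _ => ?_)
    exact mul_le_mul_of_nonneg_left (le_learnerVal hcomp
      (subset_convexHull ℝ _ (Or.inr (Set.mem_range_self i)))
      fun ψ hψ => lin_le_of_mem_convexHull hΦ i hψ) (hα.1 i)
  refine ⟨Φ, hΦ, fun Ψ hΨ => hopt hΨ, IsGreatest.csSup_eq ⟨?_, ?_⟩,
    hcomp.isClosed, hconv, hsub₁, hsub₂, hval⟩
  · exact ⟨_, hcomp.isClosed, hconv, hsub₁, hsub₂, hval.symm⟩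
  · rintro _ ⟨M, hc, -, h₁, h₂, rfl⟩
    exact hle M hc h₁ h₂
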